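/- arXiv:1411.3498 — 2 statements merged into one kernel-verified Lean document; each statement's English description precedes it below -/
import Mathlib

section
/- Let R = ℂ[x_{ijk} : i ∈ {1,2}, j ∈ {1,2}, k ∈ {1,2,3}] and let G = SL_2(ℂ) × SL_2(ℂ) × SL_3(ℂ) act on R by ℂ-algebra automorphisms determined by the linear substitution (g_1,g_2,g_3)·x_{ijk} = Σ_{i',j',k'} (g_1)_{i'i}(g_2)_{j'j}(g_3)_{k'k} x_{i'j'k'}. For every natural number d, the ℂ-vector space of polynomials in R that are homogeneous of degree d and fixed by every element of G has dimension 1 if 6 divides d, and dimension 0 otherwise. (This corresponds to the Dynkin diagram D_5, whose fundamental invariant has degree 6, and shows that (3^2, 3^2, 2^3) is a weakly stable triple.) -/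
noncomputable section

/-- The action of `(g₁, g₂, g₃) ∈ SL_{n₁}(ℂ) × SL_{n₂}(ℂ) × SL_{n₃}(ℂ)` on the
polynomial ring `ℂ[x_v : v ∈ Fin n₁ × Fin n₂ × Fin n₃]` by the linear substitution
`x_{ijk} ↦ ∑_{i',j',k'} (g₁)_{i'i} (g₂)_{j'j} (g₃)_{k'k} x_{i'j'k'}`. -/
def act (n₁ n₂ n₃ : ℕ)
    (g : Matrix.SpecialLinearGroup (Fin n₁) ℂ × Matrix.SpecialLinearGroup (Fin n₂) ℂ ×
      Matrix.SpecialLinearGroup (Fin n₃) ℂ) :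
    MvPolynomial (Fin n₁ × Fin n₂ × Fin n₃) ℂ →ₐ[ℂ] MvPolynomial (Fin n₁ × Fin n₂ × Fin n₃) ℂ :=
  MvPolynomial.aeval fun v : Fin n₁ × Fin n₂ × Fin n₃ =>
    ∑ w : Fin n₁ × Fin n₂ × Fin n₃,
      (g.1.val w.1 v.1 * g.2.1.val w.2.1 v.2.1 * g.2.2.val w.2.2 v.2.2) •
        (MvPolynomial.X w : MvPolynomial (Fin n₁ × Fin n₂ × Fin n₃) ℂ)

/-- The space of polynomials homogeneous of degree `d` fixed by every element of
`SL_{n₁}(ℂ) × SL_{n₂}(ℂ) × SL_{n₃}(ℂ)`. -/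
def invSpace (n₁ n₂ n₃ d : ℕ) :
    Submodule ℂ (MvPolynomial (Fin n₁ × Fin n₂ × Fin n₃) ℂ) :=
  MvPolynomial.homogeneousSubmodule (Fin n₁ × Fin n₂ × Fin n₃) ℂ d ⊓
    ⨅ g : Matrix.SpecialLinearGroup (Fin n₁) ℂ × Matrix.SpecialLinearGroup (Fin n₂) ℂ ×
        Matrix.SpecialLinearGroup (Fin n₃) ℂ,
      LinearMap.eqLocus (act n₁ n₂ n₃ g).toLinearMap LinearMap.id

/-- The substitution on points of `R² ⊗ R² ⊗ R³` dual to `act`, for arbitrary matrices. -/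
def pointAct {R : Type*} [CommRing R] {n₁ n₂ n₃ : ℕ} (a : Matrix (Fin n₁) (Fin n₁) R)
    (b : Matrix (Fin n₂) (Fin n₂) R) (h : Matrix (Fin n₃) (Fin n₃) R)
    (p : Fin n₁ × Fin n₂ × Fin n₃ → R) : Fin n₁ × Fin n₂ × Fin n₃ → R :=
  fun v => ∑ w : Fin n₁ × Fin n₂ × Fin n₃, a w.1 v.1 * b w.2.1 v.2.1 * h w.2.2 v.2.2 * p w

lemma eval_act {n₁ n₂ n₃ : ℕ}
    (g : Matrix.SpecialLinearGroup (Fin n₁) ℂ × Matrix.SpecialLinearGroup (Fin n₂) ℂ ×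
      Matrix.SpecialLinearGroup (Fin n₃) ℂ)
    (p : Fin n₁ × Fin n₂ × Fin n₃ → ℂ) (f : MvPolynomial (Fin n₁ × Fin n₂ × Fin n₃) ℂ) :
    MvPolynomial.eval p (act n₁ n₂ n₃ g f) =
      MvPolynomial.eval (pointAct g.1.val g.2.1.val g.2.2.val p) f := by
  have h : (MvPolynomial.aeval p).comp (act n₁ n₂ n₃ g) =
      MvPolynomial.aeval (pointAct g.1.val g.2.1.val g.2.2.val p) := by
    ext v
    simp [act, pointAct, MvPolynomial.smul_eq_C_mul]
  simpa [MvPolynomial.aeval_eq_eval] using DFunLike.congr_fun h f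

lemma mem_invSpace_iff {n₁ n₂ n₃ d : ℕ} {f : MvPolynomial (Fin n₁ × Fin n₂ × Fin n₃) ℂ} :
    f ∈ invSpace n₁ n₂ n₃ d ↔ f.IsHomogeneous d ∧
      ∀ (g : Matrix.SpecialLinearGroup (Fin n₁) ℂ × Matrix.SpecialLinearGroup (Fin n₂) ℂ ×
        Matrix.SpecialLinearGroup (Fin n₃) ℂ) (p : Fin n₁ × Fin n₂ × Fin n₃ → ℂ),
        MvPolynomial.eval (pointAct g.1.val g.2.1.val g.2.2.val p) f = MvPolynomial.eval p f := by
  simp only [invSpace, Submodule.mem_inf, MvPolynomial.mem_homogeneousSubmodule,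
    Submodule.mem_iInf, LinearMap.mem_eqLocus, AlgHom.toLinearMap_apply, LinearMap.id_apply,
    MvPolynomial.funext_iff, eval_act]

lemma eval_smul_of_isHomogeneous {σ R : Type*} [CommRing R] {d : ℕ} {f : MvPolynomial σ R}
    (hf : f.IsHomogeneous d) (c : R) (p : σ → R) :
    MvPolynomial.eval (c • p) f = c ^ d * MvPolynomial.eval p f := by
  rw [MvPolynomial.eval_eq, MvPolynomial.eval_eq, Finset.mul_sum]
  refine Finset.sum_congr rfl fun m hm => ?_
  simp only [Pi.smul_apply, smul_eq_mul, mul_pow, Finset.prod_mul_distrib,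
    Finset.prod_pow_eq_pow_sum]
  rw [hf.degree_eq_sum_deg_support hm]
  ring

/-- The determinant of three rows of a tensor viewed as a `4 × 3` matrix. -/
def rowDet {R : Type*} [CommRing R] (p : Fin 2 × Fin 2 × Fin 3 → R) (u v w : Fin 2 × Fin 2) : R :=
  Matrix.det (Matrix.of ![fun k => p (u.1, u.2, k), fun k => p (v.1, v.2, k),
    fun k => p (w.1, w.2, k)])

/-- The vector of signed maximal minors of a tensor viewed as a `4 × 3` matrix, arranged as a
`2 × 2` matrix. -/
def normal {R : Type*} [CommRing R] (p : Fin 2 × Fin 2 × Fin 3 → R) : Matrix (Fin 2) (Fin 2) R :=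
  !![rowDet p (0, 1) (1, 0) (1, 1), -rowDet p (0, 0) (1, 0) (1, 1);
     rowDet p (0, 0) (0, 1) (1, 1), -rowDet p (0, 0) (0, 1) (1, 0)]

lemma normal_orthogonal {R : Type*} [CommRing R] (p : Fin 2 × Fin 2 × Fin 3 → R) (k : Fin 3) :
    normal p 0 0 * p (0, 0, k) + normal p 0 1 * p (0, 1, k) + normal p 1 0 * p (1, 0, k) +
      normal p 1 1 * p (1, 1, k) = 0 := by
  fin_cases k <;> simp [normal, rowDet, Matrix.det_fin_three] <;> ring

lemma normal_pointAct_left {R : Type*} [CommRing R] (a : Matrix (Fin 2) (Fin 2) R)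
    (p : Fin 2 × Fin 2 × Fin 3 → R) :
    normal (pointAct a 1 1 p) = a.det • (a.adjugate * normal p) := by
  ext i j
  simp only [Matrix.smul_apply, Matrix.mul_apply, Fin.sum_univ_two]
  fin_cases i <;> fin_cases j <;>
    simp [normal, rowDet, Matrix.det_fin_three, pointAct, Fintype.sum_prod_type, Fin.sum_univ_two,
      Matrix.one_apply, Matrix.det_fin_two, Matrix.adjugate_fin_two] <;> ring

lemma normal_pointAct_right {R : Type*} [CommRing R] (b : Matrix (Fin 2) (Fin 2) R)
    (p : Fin 2 × Fin 2 × Fin 3 → R) :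
    normal (pointAct 1 b 1 p) = b.det • (normal p * b.adjugate.transpose) := by
  ext i j
  simp only [Matrix.smul_apply, Matrix.mul_apply, Fin.sum_univ_two, Matrix.transpose_apply]
  fin_cases i <;> fin_cases j <;>
    simp [normal, rowDet, Matrix.det_fin_three, pointAct, Fintype.sum_prod_type, Fin.sum_univ_two,
      Matrix.one_apply, Matrix.det_fin_two, Matrix.adjugate_fin_two] <;> ring

lemma rowDet_pointAct {R : Type*} [CommRing R] (h : Matrix (Fin 3) (Fin 3) R)
    (p : Fin 2 × Fin 2 × Fin 3 → R) (u v w : Fin 2 × Fin 2) :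
    rowDet (pointAct 1 1 h p) u v w = h.det * rowDet p u v w := by
  rw [rowDet, rowDet, mul_comm, ← Matrix.det_mul]
  congr 1
  ext i k
  fin_cases i <;>
    simp [pointAct, Fintype.sum_prod_type, Matrix.one_apply, Matrix.mul_apply, mul_comm,
      Finset.sum_ite_irrel]

lemma normal_pointAct_third {R : Type*} [CommRing R] (h : Matrix (Fin 3) (Fin 3) R)
    (p : Fin 2 × Fin 2 × Fin 3 → R) :
    normal (pointAct 1 1 h p) = h.det • normal p := by
  ext i j
  fin_cases i <;> fin_cases j <;> simp [normal, rowDet_pointAct]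

lemma pointAct_eq_comp {R : Type*} [CommRing R] (a b : Matrix (Fin 2) (Fin 2) R)
    (h : Matrix (Fin 3) (Fin 3) R) (p : Fin 2 × Fin 2 × Fin 3 → R) :
    pointAct a b h p = pointAct a 1 1 (pointAct 1 b 1 (pointAct 1 1 h p)) := by
  funext ⟨i, j, k⟩
  fin_cases i <;> fin_cases j <;>
    simp [pointAct, Fintype.sum_prod_type, Matrix.one_apply, Fin.sum_univ_two,
      Fin.sum_univ_three] <;> ring

/-- The degree six invariant of `2 × 2 × 3` tensors. -/
def disc {R : Type*} [CommRing R] (p : Fin 2 × Fin 2 × Fin 3 → R) : R := (normal p).det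

lemma disc_pointAct {R : Type*} [CommRing R] (a b : Matrix (Fin 2) (Fin 2) R)
    (h : Matrix (Fin 3) (Fin 3) R) (p : Fin 2 × Fin 2 × Fin 3 → R) :
    disc (pointAct a b h p) = a.det ^ 3 * b.det ^ 3 * h.det ^ 2 * disc p := by
  rw [pointAct_eq_comp, disc, normal_pointAct_left, normal_pointAct_right, normal_pointAct_third,
    disc]
  simp only [Matrix.det_smul, Matrix.det_mul, Matrix.det_adjugate, Matrix.det_transpose,
    Fintype.card_fin]
  ring

/-- `disc` as a polynomial in the coordinates. -/
def discPoly : MvPolynomial (Fin 2 × Fin 2 × Fin 3) ℂ := disc MvPolynomial.X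

lemma eval_discPoly (p : Fin 2 × Fin 2 × Fin 3 → ℂ) : MvPolynomial.eval p discPoly = disc p := by
  simp [discPoly, disc, normal, rowDet, Matrix.det_fin_two, Matrix.det_fin_three]

lemma isHomogeneous_rowDet (u v w : Fin 2 × Fin 2) :
    (rowDet (MvPolynomial.X : _ → MvPolynomial (Fin 2 × Fin 2 × Fin 3) ℂ) u v w).IsHomogeneous
      3 := by
  have hX : ∀ x y z : Fin 2 × Fin 2 × Fin 3, (MvPolynomial.X x * MvPolynomial.X y *
      MvPolynomial.X z : MvPolynomial (Fin 2 × Fin 2 × Fin 3) ℂ).IsHomogeneous 3 := fun x y z =>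
    ((MvPolynomial.isHomogeneous_X ℂ x).mul (MvPolynomial.isHomogeneous_X ℂ y)).mul
      (MvPolynomial.isHomogeneous_X ℂ z)
  rw [rowDet, Matrix.det_fin_three]
  exact (((((hX _ _ _).sub (hX _ _ _)).sub (hX _ _ _)).add (hX _ _ _)).add (hX _ _ _)).sub
    (hX _ _ _)

lemma isHomogeneous_discPoly : discPoly.IsHomogeneous 6 := by
  rw [discPoly, disc, Matrix.det_fin_two]
  exact ((isHomogeneous_rowDet _ _ _).mul (isHomogeneous_rowDet _ _ _).neg).sub
    ((isHomogeneous_rowDet _ _ _).neg.mul (isHomogeneous_rowDet _ _ _))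

lemma discPoly_pow_mem_invSpace (k : ℕ) : discPoly ^ k ∈ invSpace 2 2 3 (6 * k) := by
  refine mem_invSpace_iff.mpr ⟨isHomogeneous_discPoly.pow k, fun g p => ?_⟩
  simp [eval_discPoly, disc_pointAct]

/-- The tensor whose three slices are the standard basis `e, f, h` of traceless matrices. -/
def slTensor : Fin 2 × Fin 2 × Fin 3 → ℂ := fun v =>
  (![!![0, 1; 0, 0], !![0, 0; 1, 0], !![1, 0; 0, -1]] : Fin 3 → Matrix (Fin 2) (Fin 2) ℂ)
    v.2.2 v.1 v.2.1

lemma disc_slTensor_ne_zero : disc slTensor ≠ 0 := by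
  simp [disc, normal, rowDet, Matrix.det_fin_two, Matrix.det_fin_three, slTensor]

lemma exists_eq_pointAct_slTensor {p : Fin 2 × Fin 2 × Fin 3 → ℂ} (hp : disc p ≠ 0) :
    ∃ (b : Matrix (Fin 2) (Fin 2) ℂ) (h : Matrix (Fin 3) (Fin 3) ℂ),
      b.det = 1 ∧ p = pointAct 1 b h slTensor := by
  obtain ⟨s, hs⟩ := IsAlgClosed.exists_pow_nat_eq (disc p) (n := 2) two_pos
  have hs0 : s ≠ 0 := by
    rintro rfl
    exact hp (by simpa using hs.symm)
  have horth := normal_orthogonal p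
  rw [disc] at hs
  generalize normal p = N at hs horth
  rw [Matrix.det_fin_two] at hs
  refine ⟨s⁻¹ • N.adjugate.transpose, Matrix.of fun l k => s⁻¹ *
    ![p (0, 0, k) * N 1 0 + p (0, 1, k) * N 1 1, p (1, 0, k) * N 0 0 + p (1, 1, k) * N 0 1,
      p (0, 0, k) * N 0 0 + p (0, 1, k) * N 0 1] l, ?_, ?_⟩
  · rw [Matrix.det_smul, Matrix.det_transpose, Matrix.det_adjugate, Matrix.det_fin_two, ← hs]
    simp [hs0]
  · funext ⟨i, j, k⟩
    have ho := horth k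
    fin_cases i <;> fin_cases j <;>
      simp [pointAct, slTensor, Fintype.sum_prod_type, Matrix.one_apply, Fin.sum_univ_two,
        Fin.sum_univ_three, Matrix.adjugate_fin_two] <;> field_simp
    · linear_combination p (0, 0, k) * hs
    · linear_combination p (0, 1, k) * hs
    · linear_combination p (1, 0, k) * hs - N 0 1 * ho
    · linear_combination p (1, 1, k) * hs + N 0 0 * ho

lemma exists_eq_smul_pointAct_slTensor {p : Fin 2 × Fin 2 × Fin 3 → ℂ} (hp : disc p ≠ 0) :
    ∃ (c : ℂ) (b : Matrix.SpecialLinearGroup (Fin 2) ℂ) (h : Matrix.SpecialLinearGroup (Fin 3) ℂ),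
      p = c • pointAct 1 b.val h.val slTensor := by
  obtain ⟨b, h, hb, rfl⟩ := exists_eq_pointAct_slTensor hp
  obtain ⟨c, hc⟩ := IsAlgClosed.exists_pow_nat_eq h.det (n := 3) three_pos
  have hh : h.det ≠ 0 := by
    intro h0
    simp [disc_pointAct, h0] at hp
  have hc0 : c ≠ 0 := by
    rintro rfl
    exact hh (by simpa using hc.symm)
  refine ⟨c, ⟨b, hb⟩, ⟨c⁻¹ • h, ?_⟩, ?_⟩
  · rw [Matrix.det_smul, ← hc]
    simp [hc0]
  · funext v
    simp only [pointAct, Pi.smul_apply, smul_eq_mul, Finset.mul_sum, Matrix.smul_apply]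
    refine Finset.sum_congr rfl fun w _ => ?_
    field_simp

lemma eq_zero_of_eval_slTensor_eq_zero {d : ℕ} {f : MvPolynomial (Fin 2 × Fin 2 × Fin 3) ℂ}
    (hf : f ∈ invSpace 2 2 3 d) (h0 : MvPolynomial.eval slTensor f = 0) : f = 0 := by
  obtain ⟨hhom, hinv⟩ := mem_invSpace_iff.mp hf
  have hmul : f * discPoly = 0 := by
    refine MvPolynomial.funext fun p => ?_
    rw [map_mul, map_zero, eval_discPoly, mul_eq_zero, or_iff_not_imp_right]
    intro hp
    obtain ⟨c, b, h, rfl⟩ := exists_eq_smul_pointAct_slTensor hp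
    rw [eval_smul_of_isHomogeneous hhom]
    have := hinv (1, b, h) slTensor
    simp only [Matrix.SpecialLinearGroup.coe_one] at this
    rw [this, h0, mul_zero]
  refine (mul_eq_zero.mp hmul).resolve_right fun h => disc_slTensor_ne_zero ?_
  rw [← eval_discPoly, h, map_zero]

lemma pointAct_smul_one {R : Type*} [CommRing R] {n₁ n₂ n₃ : ℕ} (s t : R)
    (p : Fin n₁ × Fin n₂ × Fin n₃ → R) :
    pointAct (s • 1) 1 (t • 1) p = (s * t) • p := by
  funext ⟨i, j, k⟩
  simp [pointAct, Fintype.sum_prod_type, Matrix.one_apply]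

lemma six_dvd_of_mem_invSpace {d : ℕ} {f : MvPolynomial (Fin 2 × Fin 2 × Fin 3) ℂ}
    (hf : f ∈ invSpace 2 2 3 d) (h0 : f ≠ 0) : 6 ∣ d := by
  obtain ⟨hhom, hinv⟩ := mem_invSpace_iff.mp hf
  have hval : MvPolynomial.eval slTensor f ≠ 0 := mt (eq_zero_of_eval_slTensor_eq_zero hf) h0
  have key : ∀ s t : ℂ, s ^ 2 = 1 → t ^ 3 = 1 → (s * t) ^ d = 1 := by
    intro s t hs ht
    have := hinv (⟨s • 1, by simp [hs]⟩, 1,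
      ⟨t • 1, by simp [ht]⟩) slTensor
    simp only [Matrix.SpecialLinearGroup.coe_one] at this
    rw [pointAct_smul_one, eval_smul_of_isHomogeneous hhom] at this
    exact mul_right_cancel₀ hval (by rw [this, one_mul])
  have h2 : 2 ∣ d := by
    have := key (-1) 1 (by norm_num) (by norm_num)
    rw [mul_one] at this
    exact (IsPrimitiveRoot.neg_one 0 (by norm_num)).dvd_of_pow_eq_one d this
  have h3 : 3 ∣ d := by
    have hω := Complex.isPrimitiveRoot_exp 3 (by norm_num)
    have := key 1 _ (by norm_num) hω.pow_eq_one
    rw [one_mul] at this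
    exact hω.dvd_of_pow_eq_one d this
  omega

/-- for the action of `SL₂(ℂ) × SL₂(ℂ) × SL₃(ℂ)` on `ℂ[x_{ijk}]`, the space of invariant polynomials homogeneous of degree `d` has dimension `1` if `6 ∣ d` and `0` otherwise (Dynkin diagram `D₅`; `(3², 3², 2³)` is weakly stable). -/
theorem stmt11 (d : ℕ) :
    Module.rank ℂ ↥(invSpace 2 2 3 d) = if 6 ∣ d then 1 else 0 := by
  split_ifs with hd
  · obtain ⟨k, rfl⟩ := hd
    have hk : MvPolynomial.eval slTensor (discPoly ^ k) ≠ 0 := by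
      rw [map_pow, eval_discPoly]
      exact pow_ne_zero k disc_slTensor_ne_zero
    refine rank_eq_one (⟨discPoly ^ k, discPoly_pow_mem_invSpace k⟩ : invSpace 2 2 3 (6 * k)) ?_ ?_
    · intro h
      rw [Subtype.ext_iff] at h
      exact hk (by simp_all)
    · rintro ⟨f, hf⟩
      refine ⟨MvPolynomial.eval slTensor f / MvPolynomial.eval slTensor (discPoly ^ k), ?_⟩
      refine Subtype.ext (sub_eq_zero.mp (eq_zero_of_eval_slTensor_eq_zero (Submodule.sub_mem _
        (Submodule.smul_mem _ _ (discPoly_pow_mem_invSpace k)) hf) ?_))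
      rw [map_sub, Submodule.coe_smul, MvPolynomial.smul_eval, div_mul_cancel₀ _ hk, sub_self]
  · rw [rank_zero_iff, Submodule.subsingleton_iff_eq_bot, Submodule.eq_bot_iff]
    intro f hf
    by_contra h0
    exact hd (six_dvd_of_mem_invSpace hf h0)
end
end

section
/- Let R = ℂ[x_{ijk} : i ∈ {1,2}, j ∈ {1,2,3}, k ∈ {1,…,6}] and let G = SL_2(ℂ) × SL_3(ℂ) × SL_6(ℂ) act on R by ℂ-algebra automorphisms determined by the linear substitution (g_1,g_2,g_3)·x_{ijk} = Σ_{i',j',k'} (g_1)_{i'i}(g_2)_{j'j}(g_3)_{k'k} x_{i'j'k'}. For every natural number d, the ℂ-vector space of polynomials in R that are homogeneous of degree d and fixed by every element of G has dimension 1 if 6 divides d, and dimension 0 otherwise. (Equivalently, the rectangular Kronecker coefficient g((3n)^2, (2n)^3, n^6) equals 1 for every n ≥ 0, i.e. the generating series Σ_n g((3n)^2,(2n)^3,n^6) q^n = 1/(1−q); this is the case of the affine Dynkin diagram Ê_8, and (3^2, 2^3, 1^6) is a weakly stable triple.) -/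
noncomputable section

open MvPolynomial in
theorem MvPolynomial.IsHomogeneous.eval_smul_point {σ R : Type*} [CommSemiring R]
    {f : MvPolynomial σ R} {d : ℕ} (hf : f.IsHomogeneous d) (t : R) (x : σ → R) :
    eval (t • x) f = t ^ d * eval x f := by
  rw [eval_eq, eval_eq, Finset.mul_sum]
  refine Finset.sum_congr rfl fun m hm => ?_
  have hdeg : ∑ i ∈ m.support, m i = d := by
    rw [← hf (mem_support_iff.mp hm), Finsupp.weight_apply, Finsupp.sum]
    simp
  simp only [Pi.smul_apply, smul_eq_mul, mul_pow, Finset.prod_mul_distrib,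
    Finset.prod_pow_eq_pow_sum, hdeg]
  ring

section SquareFormat

open MvPolynomial Matrix
open scoped Kronecker

variable {n₁ n₂ n₃ : ℕ} (e : Fin n₁ × Fin n₂ ≃ Fin n₃)

/-- The tensor in `ℂ^{n₁} ⊗ ℂ^{n₂} ⊗ ℂ^{n₃}` whose flattening along `e` is the square matrix `M`. -/
def tensorOfMatrix (M : Matrix (Fin n₃) (Fin n₃) ℂ) : Fin n₁ × Fin n₂ × Fin n₃ → ℂ :=
  fun v => M (e (v.1, v.2.1)) v.2.2

/-- The determinant of the flattening of the generic tensor along `e`. -/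
def genericDet : MvPolynomial (Fin n₁ × Fin n₂ × Fin n₃) ℂ :=
  det (Matrix.of fun i k => X ((e.symm i).1, (e.symm i).2, k))

theorem tensorOfMatrix_smul (t : ℂ) (M : Matrix (Fin n₃) (Fin n₃) ℂ) :
    tensorOfMatrix e (t • M) = t • tensorOfMatrix e M := rfl

theorem tensorOfMatrix_surjective : Function.Surjective (tensorOfMatrix e) := fun x =>
  ⟨Matrix.of fun i k => x ((e.symm i).1, (e.symm i).2, k), by ext; simp [tensorOfMatrix]⟩

theorem eq_of_eval_tensorOfMatrix {p q : MvPolynomial (Fin n₁ × Fin n₂ × Fin n₃) ℂ}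
    (h : ∀ M, eval (tensorOfMatrix e M) p = eval (tensorOfMatrix e M) q) : p = q :=
  MvPolynomial.funext fun x => by
    obtain ⟨M, rfl⟩ := tensorOfMatrix_surjective e x
    exact h M

theorem eval_genericDet (M : Matrix (Fin n₃) (Fin n₃) ℂ) :
    eval (tensorOfMatrix e M) (genericDet e) = M.det := by
  rw [genericDet, RingHom.map_det]
  congr 1
  ext i k
  simp [tensorOfMatrix]

theorem genericDet_isHomogeneous : (genericDet e).IsHomogeneous n₃ := by
  rw [genericDet, det_apply]
  refine IsHomogeneous.sum _ _ _ fun σ _ => ?_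
  rw [← mem_homogeneousSubmodule, Units.smul_def, ← Int.cast_smul_eq_zsmul ℂ]
  refine Submodule.smul_mem _ _ ?_
  simpa using IsHomogeneous.prod Finset.univ
    (fun i => (X ((e.symm (σ i)).1, (e.symm (σ i)).2, i) :
      MvPolynomial (Fin n₁ × Fin n₂ × Fin n₃) ℂ)) (fun _ => 1) fun _ _ => isHomogeneous_X _ _

theorem genericDet_ne_zero : genericDet e ≠ 0 := fun h => by
  simpa [h] using eval_genericDet e 1

theorem eval_act_s16 (g : SpecialLinearGroup (Fin n₁) ℂ × SpecialLinearGroup (Fin n₂) ℂ ×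
      SpecialLinearGroup (Fin n₃) ℂ) (M : Matrix (Fin n₃) (Fin n₃) ℂ)
    (f : MvPolynomial (Fin n₁ × Fin n₂ × Fin n₃) ℂ) :
    eval (tensorOfMatrix e M) (act n₁ n₂ n₃ g f) =
      eval (tensorOfMatrix e ((reindex e e (g.1.val ⊗ₖ g.2.1.val))ᵀ * M * g.2.2.val)) f := by
  suffices h : (aeval (tensorOfMatrix e M)).comp (act n₁ n₂ n₃ g) =
      aeval (tensorOfMatrix e ((reindex e e (g.1.val ⊗ₖ g.2.1.val))ᵀ * M * g.2.2.val)) by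
    simpa [aeval_eq_eval] using DFunLike.congr_fun h f
  ext v
  simp only [act, AlgHom.comp_apply, aeval_X, map_sum, map_smul, smul_eq_mul, tensorOfMatrix,
    Matrix.mul_apply, ← e.sum_comp, Fintype.sum_prod_type, Finset.sum_mul]
  simp only [transpose_apply, reindex_apply, submatrix_apply, Equiv.symm_apply_apply,
    kroneckerMap_apply]
  refine Finset.sum_comm_cycle.trans (Finset.sum_congr rfl fun _ _ =>
    Finset.sum_comm_cycle.trans (Finset.sum_congr rfl fun _ _ =>
      Finset.sum_congr rfl fun _ _ => Finset.sum_congr rfl fun _ _ => ?_))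
  ring

theorem mem_invSpace {d : ℕ} {f : MvPolynomial (Fin n₁ × Fin n₂ × Fin n₃) ℂ} :
    f ∈ invSpace n₁ n₂ n₃ d ↔ f.IsHomogeneous d ∧ ∀ g, act n₁ n₂ n₃ g f = f := by
  simp [invSpace, LinearMap.mem_eqLocus]

theorem act_genericDet (g : SpecialLinearGroup (Fin n₁) ℂ × SpecialLinearGroup (Fin n₂) ℂ ×
      SpecialLinearGroup (Fin n₃) ℂ) : act n₁ n₂ n₃ g (genericDet e) = genericDet e := by
  refine eq_of_eval_tensorOfMatrix e fun M => ?_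
  rw [eval_act_s16, eval_genericDet, eval_genericDet, det_mul, det_mul, det_transpose,
    det_reindex_self, det_kronecker, g.1.2, g.2.1.2, g.2.2.2]
  simp

theorem genericDet_pow_mem_invSpace (m : ℕ) : genericDet e ^ m ∈ invSpace n₁ n₂ n₃ (n₃ * m) :=
  mem_invSpace.mpr ⟨(genericDet_isHomogeneous e).pow m, fun g => by
    rw [map_pow, act_genericDet]⟩

theorem eval_eq_pow_mul_of_mem_invSpace {d : ℕ}
    {f : MvPolynomial (Fin n₁ × Fin n₂ × Fin n₃) ℂ} (hf : f ∈ invSpace n₁ n₂ n₃ d)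
    {M : Matrix (Fin n₃) (Fin n₃) ℂ} {t : ℂ} (ht : t ≠ 0) (htM : t ^ n₃ = M.det) :
    eval (tensorOfMatrix e M) f = t ^ d * eval (tensorOfMatrix e 1) f := by
  obtain ⟨hhom, hinv⟩ := mem_invSpace.mp hf
  have hdet : (t⁻¹ • M).det = 1 := by
    rw [det_smul, Fintype.card_fin, ← htM, ← mul_pow, inv_mul_cancel₀ ht, one_pow]
  have hact := eval_act_s16 e (1, 1, ⟨t⁻¹ • M, hdet⟩) (t • 1) f
  rw [hinv] at hact
  rw [← hhom.eval_smul_point, ← tensorOfMatrix_smul]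
  convert hact.symm using 3
  simp [smul_smul, inv_mul_cancel₀ ht]

theorem eq_of_eval_of_det_ne_zero {p q : MvPolynomial (Fin n₁ × Fin n₂ × Fin n₃) ℂ}
    (h : ∀ M : Matrix (Fin n₃) (Fin n₃) ℂ, M.det ≠ 0 →
      eval (tensorOfMatrix e M) p = eval (tensorOfMatrix e M) q) : p = q := by
  refine mul_right_cancel₀ (genericDet_ne_zero e) (eq_of_eval_tensorOfMatrix e fun M => ?_)
  rw [map_mul, map_mul, eval_genericDet]
  by_cases hM : M.det = 0
  · simp [hM]
  · rw [h M hM]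

theorem exists_pow_eq_det [NeZero n₃] {M : Matrix (Fin n₃) (Fin n₃) ℂ} (hM : M.det ≠ 0) :
    ∃ t : ℂ, t ≠ 0 ∧ t ^ n₃ = M.det := by
  obtain ⟨t, ht⟩ := IsAlgClosed.exists_pow_nat_eq M.det (NeZero.pos n₃)
  refine ⟨t, ?_, ht⟩
  rintro rfl
  exact hM (by rw [← ht, zero_pow (NeZero.ne n₃)])

theorem invSpace_eq_bot [NeZero n₃] (e : Fin n₁ × Fin n₂ ≃ Fin n₃) {d : ℕ} (hd : ¬ n₃ ∣ d) :
    invSpace n₁ n₂ n₃ d = ⊥ := by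
  refine (Submodule.eq_bot_iff _).mpr fun f hf => ?_
  have hζ := Complex.isPrimitiveRoot_exp n₃ (NeZero.ne n₃)
  have hone : eval (tensorOfMatrix e 1) f = 0 := by
    have h := eval_eq_pow_mul_of_mem_invSpace e hf (M := 1) (hζ.ne_zero (NeZero.ne n₃))
      (by rw [hζ.pow_eq_one, det_one])
    by_contra h0
    exact hd ((hζ.pow_eq_one_iff_dvd d).mp (mul_right_cancel₀ h0 (by rw [← h, one_mul])))
  refine eq_of_eval_of_det_ne_zero e fun M hM => ?_
  obtain ⟨t, ht, htM⟩ := exists_pow_eq_det hM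
  rw [eval_eq_pow_mul_of_mem_invSpace e hf ht htM, hone, mul_zero, map_zero]

theorem eq_smul_genericDet_pow_of_mem_invSpace [NeZero n₃] {m : ℕ}
    {f : MvPolynomial (Fin n₁ × Fin n₂ × Fin n₃) ℂ} (hf : f ∈ invSpace n₁ n₂ n₃ (n₃ * m)) :
    f = eval (tensorOfMatrix e 1) f • genericDet e ^ m := by
  refine eq_of_eval_of_det_ne_zero e fun M hM => ?_
  obtain ⟨t, ht, htM⟩ := exists_pow_eq_det hM
  rw [eval_eq_pow_mul_of_mem_invSpace e hf ht htM, smul_eval, map_pow, eval_genericDet, ← htM,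
    ← pow_mul, mul_comm]

theorem rank_invSpace [NeZero n₃] (e : Fin n₁ × Fin n₂ ≃ Fin n₃) (d : ℕ) :
    Module.rank ℂ ↥(invSpace n₁ n₂ n₃ d) = if n₃ ∣ d then 1 else 0 := by
  split_ifs with hd
  · obtain ⟨m, rfl⟩ := hd
    refine rank_eq_one (⟨genericDet e ^ m, genericDet_pow_mem_invSpace e m⟩ :
      invSpace n₁ n₂ n₃ (n₃ * m)) ?_ fun f => ⟨eval (tensorOfMatrix e 1) f.1, ?_⟩
    · exact fun h => pow_ne_zero m (genericDet_ne_zero e) (congrArg Subtype.val h)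
    · exact Subtype.ext (eq_smul_genericDet_pow_of_mem_invSpace e f.2).symm
  · rw [invSpace_eq_bot e hd, rank_bot]

end SquareFormat

/-- for the action of `SL₂(ℂ) × SL₃(ℂ) × SL₆(ℂ)` on `ℂ[x_{ijk}]`, the space of invariant polynomials homogeneous of degree `d` has dimension `1` if `6 ∣ d` and `0` otherwise (affine Dynkin diagram `Ê₈`; `g((3n)², (2n)³, n⁶) = 1` for all `n`, and `(3², 2³, 1⁶)` is weakly stable). -/
theorem stmt16 (d : ℕ) :
    Module.rank ℂ ↥(invSpace 2 3 6 d) = if 6 ∣ d then 1 else 0 := by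
  exact rank_invSpace (n₁ := 2) (n₂ := 3) (n₃ := 6) finProdFinEquiv d
end
end
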